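/- arXiv:1101.5144 — 4 statements merged into one kernel-verified Lean document; each statement's English description precedes it below -/
import Mathlib

section
/- Assume N is even, N ≥ 6, ⟨L_{N−1},L_{N−2}⟩₁ ≠ 0 and ⟨L_{N−3},L_{N−4}⟩₁ ≠ 0. Let π_{N,1} and π_{N+1,1} be the monic skew-orthogonal polynomials, with π_{N+1,1} normalized with c = 0 in its Laguerre expansion. Then for each l ∈ {3,4} there exist a unique polynomial q_l with deg q_l ≤ N−1 and unique constants Q_{l−2,1}, Q_{l−2,2} ∈ ℂ such that L_{N−l} = T(q_l) + Q_{l−2,1}·π_{N+1,1} + Q_{l−2,2}·π_{N,1}, and these constants are given, for i ∈ {1,2}, by: Q_{i,1} = −M·⟨L_{N−1}, L_{N−i−2}⟩₁/(2·h_{N−1,0}) and Q_{i,2} = (Mt − (N+M))·⟨L_{N−1}, L_{N−i−2}⟩₁/(2·h_{N−1,0}) − M·⟨L_{N−2}, L_{N−i−2}⟩₁/(2·h_{N−2,0}). -/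
open MeasureTheory Polynomial Set

noncomputable section

/-- The weight `w(x) = e^{−Mx/2}·x^{(M−N−1)/2}·(t−x)^{−1/2}` on `(0,∞)`,
using the principal branch of the complex power. -/
def wC (M N : ℕ) (t : ℂ) (x : ℝ) : ℂ :=
  Complex.exp (-(M : ℂ) * x / 2) * (x : ℂ) ^ (((((M : ℝ) - N - 1) / 2 : ℝ)) : ℂ) *
    (t - x) ^ (-(1 / 2) : ℂ)

/-- The Laguerre weight `w₀(x) = x^{M−N}·e^{−Mx}`. -/
def w0R (M N : ℕ) (x : ℝ) : ℝ := x ^ (M - N) * Real.exp (-(M : ℝ) * x)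

/-- The skew product `⟨f,g⟩₁ = ∫₀^∞∫₀^∞ (1/2)·sgn(x−y)·f(x)·g(y)·w(x)·w(y) dy dx`. -/
def skew1 (M N : ℕ) (t : ℂ) (f g : Polynomial ℂ) : ℂ :=
  ∫ x in Ioi (0 : ℝ), ∫ y in Ioi (0 : ℝ),
    ((Real.sign (x - y) : ℝ) : ℂ) / 2 * f.eval (x : ℂ) * g.eval (y : ℂ) *
      wC M N t x * wC M N t y

/-- The inner product `⟨f,g⟩₂ = ∫₀^∞ f(x)·g(x)·w₀(x) dx`. -/
def inner2C (M N : ℕ) (f g : Polynomial ℂ) : ℂ :=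
  ∫ x in Ioi (0 : ℝ), f.eval (x : ℂ) * g.eval (x : ℂ) * (w0R M N x : ℂ)

/-- `IsLag M N L` says that `L n` is the monic degree-`n` orthogonal polynomial for the
weight `w₀` (the rescaled Laguerre polynomial). -/
def IsLag (M N : ℕ) (L : ℕ → Polynomial ℂ) : Prop :=
  ∀ n, (L n).Monic ∧ (L n).natDegree = n ∧
    ∀ j, j < n → inner2C M N (L n) (Polynomial.X ^ j) = 0

/-- The operator `T(q)(x) = x(t−x)q′(x) +
[(t−2x) − (M/2)x(t−x) + ((M−N−1)/2)(t−x) + x/2]·q(x)`,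
i.e. formally `T(q) = (d/dx)(q·x·(t−x)·w)/w`. -/
def Tq (M N : ℕ) (t : ℂ) (q : Polynomial ℂ) : Polynomial ℂ :=
  Polynomial.X * (Polynomial.C t - Polynomial.X) * Polynomial.derivative q +
    ((Polynomial.C t - 2 * Polynomial.X)
        - Polynomial.C ((M : ℂ) / 2) * (Polynomial.X * (Polynomial.C t - Polynomial.X))
        + Polynomial.C (((M : ℂ) - N - 1) / 2) * (Polynomial.C t - Polynomial.X)
        + Polynomial.C (1 / 2) * Polynomial.X) * q

/-- `ε(f)(x) = ∫₀^∞ (1/2)·sgn(x−y)·f(y) dy`. -/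
def epsC (f : ℝ → ℂ) (x : ℝ) : ℂ :=
  ∫ y in Ioi (0 : ℝ), ((Real.sign (x - y) : ℝ) : ℂ) / 2 * f y

/-- The squared norm `h_{n,0} = ∫₀^∞ L_n(x)²·w₀(x) dx`. -/
def hC (M N : ℕ) (L : ℕ → Polynomial ℂ) (n : ℕ) : ℂ :=
  ∫ x in Ioi (0 : ℝ), (L n).eval (x : ℂ) ^ 2 * (w0R M N x : ℂ)

end

section Analysis

variable {M N : ℕ} {t : ℂ}

lemma sub_ofReal_mem_slitPlane (ht : t.im ≠ 0) (x : ℝ) : t - x ∈ Complex.slitPlane :=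
  Complex.mem_slitPlane_iff.2 (Or.inr (by simpa using ht))

lemma sub_ofReal_ne_zero (ht : t.im ≠ 0) (x : ℝ) : t - x ≠ 0 :=
  Complex.slitPlane_ne_zero (sub_ofReal_mem_slitPlane ht x)

lemma hasDerivAt_wC (ht : t.im ≠ 0) {x : ℝ} (hx : 0 < x) :
    HasDerivAt (wC M N t)
      (wC M N t x * (-(M : ℂ) / 2 + (((M : ℂ) - N - 1) / 2) / x + 1 / (2 * (t - x)))) x := by
  have hx0 : (x : ℂ) ≠ 0 := by exact_mod_cast hx.ne'
  have htx := sub_ofReal_ne_zero ht x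
  have h1 : HasDerivAt (fun z : ℂ => Complex.exp (-(M : ℂ) * z / 2))
      (Complex.exp (-(M : ℂ) * x / 2) * (-(M : ℂ) * 1 / 2)) (x : ℂ) :=
    (((hasDerivAt_id (x : ℂ)).const_mul (-(M : ℂ))).div_const 2).cexp
  have h2 := (hasDerivAt_id (x : ℂ)).cpow_const (c := (((((M : ℝ) - N - 1) / 2 : ℝ)) : ℂ))
    (Or.inl (by simpa using hx))
  have h3 := ((hasDerivAt_id (x : ℂ)).const_sub t).cpow_const (c := (-(1 / 2) : ℂ))
    (sub_ofReal_mem_slitPlane ht x)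
  have h := ((h1.mul h2).mul h3).comp_ofReal
  refine h.congr_deriv ?_
  simp only [id, Pi.mul_apply]
  rw [Complex.cpow_sub _ _ hx0, Complex.cpow_sub _ _ htx, Complex.cpow_one, Complex.cpow_one, wC]
  push_cast
  field_simp

lemma norm_wC_le (ht : t.im ≠ 0) {x : ℝ} (hx : 0 < x) :
    ‖wC M N t x‖ ≤ |t.im| ^ (-(1 / 2) : ℝ) *
      (x ^ (((M : ℝ) - N - 1) / 2) * Real.exp (-((M : ℝ) / 2) * x)) := by
  have e : (-(1 / 2) : ℂ) = ((-(1 / 2) : ℝ) : ℂ) := by push_cast; rfl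
  have h3 : ‖(t - x) ^ (-(1 / 2) : ℂ)‖ ≤ |t.im| ^ (-(1 / 2) : ℝ) := by
    rw [e, Complex.norm_cpow_real]
    refine Real.rpow_le_rpow_of_nonpos (abs_pos.2 ht) ?_ (by norm_num)
    simpa using Complex.abs_im_le_norm (t - x)
  have h1 : ‖Complex.exp (-(M : ℂ) * x / 2)‖ = Real.exp (-((M : ℝ) / 2) * x) := by
    rw [Complex.norm_exp]
    congr 1
    have : (-(M : ℂ) * x / 2) = ((-((M : ℝ) / 2) * x : ℝ) : ℂ) := by push_cast; ring
    rw [this, Complex.ofReal_re]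
  rw [wC, norm_mul, norm_mul, h1, Complex.norm_cpow_eq_rpow_re_of_pos hx, Complex.ofReal_re]
  calc _ ≤ Real.exp (-((M : ℝ) / 2) * x) * x ^ (((M : ℝ) - N - 1) / 2) *
        |t.im| ^ (-(1 / 2) : ℝ) := by gcongr
    _ = _ := by ring

lemma aestronglyMeasurable_wC (ht : t.im ≠ 0) :
    AEStronglyMeasurable (wC M N t) (volume.restrict (Ioi 0)) :=
  ContinuousOn.aestronglyMeasurable
    (fun _ hx => (hasDerivAt_wC ht hx).continuousAt.continuousWithinAt) measurableSet_Ioi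

lemma integrableOn_eval_mul_wC (hNM : N < M) (ht : t.im ≠ 0) (p : ℂ[X]) :
    IntegrableOn (fun x : ℝ => p.eval (x : ℂ) * wC M N t x) (Ioi 0) := by
  have hMN : (N : ℝ) + 1 ≤ M := by exact_mod_cast hNM
  induction p using Polynomial.induction_on' with
  | add p q hp hq =>
    simp only [eval_add, add_mul]
    exact hp.add hq
  | monomial n a =>
    have hM : (0 : ℝ) < M := by exact_mod_cast (Nat.zero_le N).trans_lt hNM
    have h := (integrableOn_rpow_mul_exp_neg_mul_rpow (p := 1) (b := (M : ℝ) / 2)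
      (s := (n : ℝ) + ((M : ℝ) - N - 1) / 2)
      (by have : (0 : ℝ) ≤ n := n.cast_nonneg
          linarith) one_pos (by positivity)).const_mul
      (‖a‖ * |t.im| ^ (-(1 / 2) : ℝ))
    refine Integrable.mono' h ?_ ?_
    · exact (Continuous.aestronglyMeasurable (by fun_prop)).mul (aestronglyMeasurable_wC ht)
    · refine (ae_restrict_iff' measurableSet_Ioi).2 (Filter.Eventually.of_forall fun x hx => ?_)
      have hx : 0 < x := hx
      rw [norm_mul, eval_monomial, norm_mul, norm_pow, Complex.norm_real, Real.norm_of_nonneg hx.le]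
      calc _ ≤ ‖a‖ * x ^ n * (|t.im| ^ (-(1 / 2) : ℝ) *
          (x ^ (((M : ℝ) - N - 1) / 2) * Real.exp (-((M : ℝ) / 2) * x))) := by
            gcongr; exact norm_wC_le ht hx
        _ = _ := by
          rw [Real.rpow_add hx, Real.rpow_natCast, Real.rpow_one]
          ring

/-- The function `q·x·(t−x)·w` is a primitive of `T(q)·w`. -/
lemma hasDerivAt_primitive (ht : t.im ≠ 0) (q : ℂ[X]) {x : ℝ} (hx : 0 < x) :
    HasDerivAt (fun y : ℝ => (q * (X * (C t - X))).eval (y : ℂ) * wC M N t y)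
      ((Tq M N t q).eval (x : ℂ) * wC M N t x) x := by
  have hx0 : (x : ℂ) ≠ 0 := by exact_mod_cast hx.ne'
  have htx := sub_ofReal_ne_zero ht x
  have h := (((q * (X * (C t - X))).hasDerivAt (x : ℂ)).comp_ofReal).mul
    (hasDerivAt_wC (M := M) (N := N) ht hx)
  refine h.congr_deriv ?_
  simp only [Tq, derivative_mul, derivative_X, derivative_sub, derivative_C, eval_add, eval_mul,
    eval_sub, eval_X, eval_C, eval_one, eval_zero, eval_ofNat]
  field_simp
  ring

lemma tendsto_primitive_zero (hNM : N < M) (ht : t.im ≠ 0) (q : ℂ[X]) :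
    Filter.Tendsto (fun y : ℝ => (q * (X * (C t - X))).eval (y : ℂ) * wC M N t y)
      (nhdsWithin 0 (Ioi 0)) (nhds 0) := by
  have hMN : (N : ℝ) + 1 ≤ M := by exact_mod_cast hNM
  set a : ℝ := ((M : ℝ) - N - 1) / 2 with ha
  have ha0 : 0 ≤ a := by rw [ha]; linarith
  have hc : ContinuousAt (fun y : ℝ => (y : ℂ) ^ ((a : ℂ) + 1) * (q.eval (y : ℂ) *
      ((t - y) * (Complex.exp (-(M : ℂ) * y / 2) * (t - y) ^ (-(1 / 2) : ℂ))))) 0 := by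
    have h1 : Continuous (fun y : ℝ => (y : ℂ) ^ ((a : ℂ) + 1)) :=
      Complex.continuous_ofReal_cpow_const (by simp; linarith)
    have h2 : ContinuousAt (fun y : ℝ => (t - y) ^ (-(1 / 2) : ℂ)) 0 :=
      ContinuousAt.cpow (by fun_prop) continuousAt_const (sub_ofReal_mem_slitPlane ht 0)
    have h3 : Continuous (fun y : ℝ => q.eval (y : ℂ)) := by fun_prop
    have h4 : Continuous (fun y : ℝ => Complex.exp (-(M : ℂ) * y / 2)) := by fun_prop
    have h5 : Continuous (fun y : ℝ => t - (y : ℂ)) := by fun_prop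
    exact h1.continuousAt.mul (h3.continuousAt.mul (h5.continuousAt.mul (h4.continuousAt.mul h2)))
  have hv : ((0 : ℝ) : ℂ) ^ ((a : ℂ) + 1) = 0 := by
    rw [Complex.ofReal_zero, Complex.zero_cpow]
    have : (a : ℂ) + 1 = ((a + 1 : ℝ) : ℂ) := by push_cast; rfl
    rw [this]
    exact_mod_cast (by linarith : (0 : ℝ) < a + 1).ne'
  have h := hc.tendsto
  rw [hv, zero_mul] at h
  refine (h.mono_left nhdsWithin_le_nhds).congr' ?_
  filter_upwards [self_mem_nhdsWithin] with y hy
  have hy0 : (y : ℂ) ≠ 0 := by exact_mod_cast (ne_of_gt hy)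
  rw [Complex.cpow_add _ _ hy0, Complex.cpow_one, wC]
  simp only [eval_mul, eval_sub, eval_X, eval_C]
  ring

/-- The transform `ε(T(q)·w)` equals `q·x·(t−x)·w`. -/
lemma integral_sign_mul_Tq (hNM : N < M) (ht : t.im ≠ 0) (q : ℂ[X]) {x : ℝ} (hx : 0 < x) :
    ∫ y in Ioi (0 : ℝ), ((Real.sign (x - y) : ℝ) : ℂ) / 2 * ((Tq M N t q).eval (y : ℂ) * wC M N t y)
      = (q * (X * (C t - X))).eval (x : ℂ) * wC M N t x := by
  set F : ℝ → ℂ := fun y => (q * (X * (C t - X))).eval (y : ℂ) * wC M N t y with hF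
  set F' : ℝ → ℂ := fun y => (Tq M N t q).eval (y : ℂ) * wC M N t y with hF'
  have hd : ∀ y ∈ Ioi (0 : ℝ), HasDerivAt F (F' y) y := fun y hy => hasDerivAt_primitive ht q hy
  have hi : IntegrableOn F' (Ioi 0) := integrableOn_eval_mul_wC hNM ht _
  have hiF : IntegrableOn F (Ioi 0) := integrableOn_eval_mul_wC hNM ht _
  have hi1 : IntegrableOn F' (Ioc 0 x) := hi.mono_set Ioc_subset_Ioi_self
  have hi2 : IntegrableOn F' (Ioi x) := hi.mono_set (Ioi_subset_Ioi hx.le)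
  have hlow : ∫ y in Ioc 0 x, F' y = F x := by
    rw [← intervalIntegral.integral_of_le hx.le,
      intervalIntegral.integral_eq_sub_of_hasDerivAt_of_tendsto hx (fun y hy => hd y hy.1)
        ((intervalIntegrable_iff_integrableOn_Ioc_of_le hx.le).2 hi1)
        (tendsto_primitive_zero hNM ht q)
        ((hd x hx).continuousAt.tendsto.mono_left nhdsWithin_le_nhds), sub_zero]
  have hhigh : ∫ y in Ioi x, F' y = - F x := by
    rw [integral_Ioi_of_hasDerivAt_of_tendsto' (fun y hy => hd y (lt_of_lt_of_le hx hy)) hi2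
      (tendsto_zero_of_hasDerivAt_of_integrableOn_Ioi hd hi hiF), zero_sub]
  have e1 : ∀ᵐ y, y ∈ Ioc 0 x → ((Real.sign (x - y) : ℝ) : ℂ) / 2 * F' y = 1 / 2 * F' y := by
    filter_upwards [compl_mem_ae_iff.2 (measure_singleton x)] with y hy hyx
    have : 0 < x - y := sub_pos.2 (lt_of_le_of_ne hyx.2 hy)
    rw [Real.sign_of_pos this]; simp
  have e2 : EqOn (fun y => ((Real.sign (x - y) : ℝ) : ℂ) / 2 * F' y) (fun y => -(1 / 2) * F' y)
      (Ioi x) := by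
    intro y hy
    have : x - y < 0 := sub_neg.2 hy
    simp only [Real.sign_of_neg this]; push_cast; ring
  have hI1 : IntegrableOn (fun y => ((Real.sign (x - y) : ℝ) : ℂ) / 2 * F' y) (Ioc 0 x) :=
    (hi1.const_mul (1 / 2)).congr (((ae_restrict_iff' measurableSet_Ioc).2 e1).mono
      fun _ h => h.symm)
  have hI2 : IntegrableOn (fun y => ((Real.sign (x - y) : ℝ) : ℂ) / 2 * F' y) (Ioi x) :=
    IntegrableOn.congr_fun (hi2.const_mul (-(1 / 2))) e2.symm measurableSet_Ioi
  rw [← Ioc_union_Ioi_eq_Ioi hx.le, setIntegral_union (Ioc_disjoint_Ioi le_rfl) measurableSet_Ioi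
    hI1 hI2, setIntegral_congr_ae measurableSet_Ioc e1, setIntegral_congr_fun measurableSet_Ioi e2,
    integral_const_mul, integral_const_mul, hlow, hhigh]
  ring

lemma wC_mul_self (hNM : N < M) (ht : t.im ≠ 0) {x : ℝ} (hx : 0 < x) :
    (x : ℂ) * (t - x) * (wC M N t x * wC M N t x) = (w0R M N x : ℂ) := by
  have hx0 : (x : ℂ) ≠ 0 := by exact_mod_cast hx.ne'
  have htx := sub_ofReal_ne_zero ht x
  have h1 : Complex.exp (-(M : ℂ) * x / 2) * Complex.exp (-(M : ℂ) * x / 2) =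
      Complex.exp (-(M : ℂ) * x) := by rw [← Complex.exp_add]; ring_nf
  have h2 : (x : ℂ) * ((x : ℂ) ^ (((((M : ℝ) - N - 1) / 2 : ℝ)) : ℂ) *
      (x : ℂ) ^ (((((M : ℝ) - N - 1) / 2 : ℝ)) : ℂ)) = (x : ℂ) ^ (M - N) := by
    rw [← Complex.cpow_add _ _ hx0, ← Complex.cpow_natCast, Nat.cast_sub hNM.le]
    nth_rewrite 1 [← Complex.cpow_one (x : ℂ)]
    rw [← Complex.cpow_add _ _ hx0]
    congr 1
    push_cast
    ring
  have h3 : (t - x) * ((t - x) ^ (-(1 / 2) : ℂ) * (t - x) ^ (-(1 / 2) : ℂ)) = 1 := by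
    rw [← Complex.cpow_add _ _ htx]
    norm_num [Complex.cpow_neg_one]
    exact mul_inv_cancel₀ htx
  rw [w0R]
  push_cast
  rw [← h1, ← h2, wC]
  linear_combination (Complex.exp (-(M : ℂ) * x / 2) * Complex.exp (-(M : ℂ) * x / 2)) *
    ((x : ℂ) * ((x : ℂ) ^ (((((M : ℝ) - N - 1) / 2 : ℝ)) : ℂ) *
      (x : ℂ) ^ (((((M : ℝ) - N - 1) / 2 : ℝ)) : ℂ))) * h3

/-- Pairing with the image of `T` turns the skew product into the Laguerre inner product. -/
lemma skew1_Tq (hNM : N < M) (ht : t.im ≠ 0) (p q : ℂ[X]) :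
    skew1 M N t p (Tq M N t q) = inner2C M N p q := by
  rw [skew1, inner2C]
  refine setIntegral_congr_fun measurableSet_Ioi fun x hx => ?_
  calc _ = ∫ y in Ioi (0 : ℝ), (p.eval (x : ℂ) * wC M N t x) *
        (((Real.sign (x - y) : ℝ) : ℂ) / 2 * ((Tq M N t q).eval (y : ℂ) * wC M N t y)) := by
          congr 1; ext y; ring
    _ = _ := by
      rw [integral_const_mul, integral_sign_mul_Tq hNM ht q hx, ← wC_mul_self hNM ht hx]
      simp only [eval_mul, eval_sub, eval_X, eval_C]
      ring

lemma integrable_skew1_kernel (hNM : N < M) (ht : t.im ≠ 0) (f g : ℂ[X]) :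
    Integrable (fun z : ℝ × ℝ => ((Real.sign (z.1 - z.2) : ℝ) : ℂ) / 2 * f.eval (z.1 : ℂ) *
      g.eval (z.2 : ℂ) * wC M N t z.1 * wC M N t z.2)
      ((volume.restrict (Ioi 0)).prod (volume.restrict (Ioi 0))) := by
  have h := ((integrableOn_eval_mul_wC hNM ht f).integrable.mul_prod
    (integrableOn_eval_mul_wC hNM ht g).integrable).bdd_mul (c := 1)
    (f := fun z : ℝ × ℝ => ((Real.sign (z.1 - z.2) : ℝ) : ℂ) / 2) ?_ ?_
  · refine h.congr (Filter.Eventually.of_forall fun z => ?_)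
    simp only
    ring
  · have : Measurable Real.sign :=
      Measurable.ite measurableSet_Iio measurable_const
        (Measurable.ite measurableSet_Ioi measurable_const measurable_const)
    exact (((Complex.measurable_ofReal.comp
      (this.comp (measurable_fst.sub measurable_snd))).div_const 2)).aestronglyMeasurable
  · refine Filter.Eventually.of_forall fun z => ?_
    rcases Real.sign_apply_eq (z.1 - z.2) with h | h | h <;> rw [h] <;> norm_num

lemma skew1_eq_integral_prod (hNM : N < M) (ht : t.im ≠ 0) (f g : ℂ[X]) :
    skew1 M N t f g = ∫ z : ℝ × ℝ, ((Real.sign (z.1 - z.2) : ℝ) : ℂ) / 2 * f.eval (z.1 : ℂ) *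
      g.eval (z.2 : ℂ) * wC M N t z.1 * wC M N t z.2
      ∂((volume.restrict (Ioi 0)).prod (volume.restrict (Ioi 0))) :=
  (integral_prod _ (integrable_skew1_kernel hNM ht f g)).symm

lemma skew1_swap (hNM : N < M) (ht : t.im ≠ 0) (f g : ℂ[X]) :
    skew1 M N t f g = -skew1 M N t g f := by
  rw [skew1_eq_integral_prod hNM ht, skew1_eq_integral_prod hNM ht g f, ← integral_neg,
    ← integral_prod_swap]
  congr 1
  ext z
  simp only [Prod.fst_swap, Prod.snd_swap]
  rw [← neg_sub z.1 z.2, Real.sign_neg]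
  push_cast
  ring

/-- The skew product as a bilinear form. -/
noncomputable def skewForm (hNM : N < M) (ht : t.im ≠ 0) : ℂ[X] →ₗ[ℂ] ℂ[X] →ₗ[ℂ] ℂ :=
  have hadd : ∀ f g k : ℂ[X], skew1 M N t (f + g) k = skew1 M N t f k + skew1 M N t g k :=
    fun f g k => by
      simp only [skew1_eq_integral_prod hNM ht]
      rw [← integral_add (integrable_skew1_kernel hNM ht _ _) (integrable_skew1_kernel hNM ht _ _)]
      congr 1; ext z; simp only [eval_add]; ring
  have hsmul : ∀ (c : ℂ) (f k : ℂ[X]), skew1 M N t (c • f) k = c • skew1 M N t f k :=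
    fun c f k => by
      simp only [skew1_eq_integral_prod hNM ht]
      rw [smul_eq_mul, ← integral_const_mul]
      congr 1; ext z; simp only [eval_smul, smul_eq_mul]; ring
  LinearMap.mk₂ ℂ (skew1 M N t) hadd hsmul
    (fun f g k => by
      rw [skew1_swap hNM ht, hadd, skew1_swap hNM ht f g, skew1_swap hNM ht f k]; ring)
    (fun c f g => by
      rw [skew1_swap hNM ht, hsmul, skew1_swap hNM ht f g, smul_neg])

lemma skewForm_apply (hNM : N < M) (ht : t.im ≠ 0) (f g : ℂ[X]) :
    skewForm hNM ht f g = skew1 M N t f g := rfl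

lemma integrableOn_pow_mul_w0R (hNM : N < M) (n : ℕ) :
    IntegrableOn (fun x : ℝ => x ^ n * w0R M N x) (Ioi 0) := by
  have hM : (0 : ℝ) < M := by exact_mod_cast (Nat.zero_le N).trans_lt hNM
  have h := integrableOn_rpow_mul_exp_neg_mul_rpow (p := 1) (b := (M : ℝ))
    (s := ((n + (M - N) : ℕ) : ℝ)) (lt_of_lt_of_le neg_one_lt_zero (Nat.cast_nonneg _)) one_pos hM
  refine h.congr_fun (fun x _ => ?_) measurableSet_Ioi
  simp only [Real.rpow_natCast, Real.rpow_one, w0R, pow_add]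
  ring

lemma integrableOn_eval_mul_w0R (hNM : N < M) (p : ℂ[X]) :
    IntegrableOn (fun x : ℝ => p.eval (x : ℂ) * (w0R M N x : ℂ)) (Ioi 0) := by
  induction p using Polynomial.induction_on' with
  | add p q hp hq =>
    simp only [eval_add, add_mul]
    exact hp.add hq
  | monomial n a =>
    refine ((integrableOn_pow_mul_w0R hNM n).ofReal (𝕜 := ℂ) |>.const_mul a).congr
      (Filter.Eventually.of_forall fun x => ?_)
    simp [eval_monomial]
    ring

/-- Integration against the Laguerre weight, as a linear functional. -/
noncomputable def lagInt (hNM : N < M) : ℂ[X] →ₗ[ℂ] ℂ where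
  toFun p := ∫ x in Ioi (0 : ℝ), p.eval (x : ℂ) * (w0R M N x : ℂ)
  map_add' p q := by
    rw [← integral_add (integrableOn_eval_mul_w0R hNM p) (integrableOn_eval_mul_w0R hNM q)]
    simp only [eval_add, add_mul]
  map_smul' c p := by
    rw [RingHom.id_apply, smul_eq_mul, ← integral_const_mul]
    simp only [eval_smul, smul_eq_mul, mul_assoc]

lemma inner2C_eq_lagInt (hNM : N < M) (f g : ℂ[X]) : inner2C M N f g = lagInt hNM (f * g) := by
  simp [inner2C, lagInt]

lemma hC_eq_lagInt (hNM : N < M) (L : ℕ → ℂ[X]) (n : ℕ) :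
    hC M N L n = lagInt hNM (L n * L n) := by
  simp [hC, lagInt, pow_two]

lemma lagInt_X_pow (hNM : N < M) (n : ℕ) :
    lagInt hNM (X ^ n) =
      (((1 / (M : ℝ)) ^ (((n + (M - N) : ℕ) : ℝ) + 1) *
        Real.Gamma (((n + (M - N) : ℕ) : ℝ) + 1) : ℝ) : ℂ) := by
  have hM : (0 : ℝ) < M := by exact_mod_cast (Nat.zero_le N).trans_lt hNM
  rw [← Real.integral_rpow_mul_exp_neg_mul_Ioi (by positivity) hM, ← integral_complex_ofReal]
  refine setIntegral_congr_fun measurableSet_Ioi fun x _ => ?_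
  simp only [eval_pow, eval_X, w0R, add_sub_cancel_right, Real.rpow_natCast, pow_add, neg_mul]
  push_cast
  ring

/-- Integration by parts against the Laguerre weight. -/
lemma lagInt_by_parts (hNM : N < M) (p : ℂ[X]) :
    lagInt hNM (X * derivative p) + ((M : ℂ) - N + 1) * lagInt hNM p =
      M * lagInt hNM (X * p) := by
  have hM : (0 : ℝ) < M := by exact_mod_cast (Nat.zero_le N).trans_lt hNM
  induction p using Polynomial.induction_on' with
  | add p q hp hq =>
    simp only [mul_add, map_add] at hp hq ⊢
    linear_combination hp + hq
  | monomial n a =>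
    have h1 : X * derivative (monomial n a) = (a * n) • (X ^ n : ℂ[X]) := by
      rw [derivative_monomial, X_mul_monomial, ← C_mul_X_pow_eq_monomial, smul_eq_C_mul]
      rcases n with _ | n <;> simp
    have h2 : monomial n a = a • (X ^ n : ℂ[X]) := by
      rw [← C_mul_X_pow_eq_monomial, smul_eq_C_mul]
    have h3 : X * monomial n a = a • (X ^ (n + 1) : ℂ[X]) := by
      rw [X_mul_monomial, ← C_mul_X_pow_eq_monomial, smul_eq_C_mul]
    rw [h1, h2, show X * (a • (X ^ n : ℂ[X])) = a • (X ^ (n + 1) : ℂ[X]) by rw [← h2, h3]]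
    simp only [map_smul, smul_eq_mul, lagInt_X_pow]
    have e : ((n + 1 + (M - N) : ℕ) : ℝ) + 1 = (((n + (M - N) : ℕ) : ℝ) + 1) + 1 := by
      push_cast; ring
    have hs : (0 : ℝ) < ((n + (M - N) : ℕ) : ℝ) + 1 := by positivity
    have hv : (((((n + (M - N) : ℕ) : ℝ) + 1 : ℝ)) : ℂ) = (n : ℂ) + M - N + 1 := by
      push_cast [Nat.cast_sub hNM.le]; ring
    rw [e]
    generalize ((n + (M - N) : ℕ) : ℝ) + 1 = s at hs hv ⊢
    rw [Real.Gamma_add_one hs.ne', Real.rpow_add_one (by positivity)]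
    simp only [Complex.ofReal_mul, hv]
    have hM0 : (M : ℂ) ≠ 0 := by exact_mod_cast hM.ne'
    have hinv : (M : ℂ) * ((1 / (M : ℝ) : ℝ) : ℂ) = 1 := by
      push_cast; field_simp
    linear_combination -(a * (((1 / (M : ℝ)) ^ s : ℝ) : ℂ) * (n + M - N + 1) * Real.Gamma s) * hinv

lemma lagInt_conj_mul_ne_zero (hNM : N < M) {q : ℂ[X]} (hq : q ≠ 0) :
    lagInt hNM (q.map (starRingEnd ℂ) * q) ≠ 0 := by
  have hev : ∀ x : ℝ, (q.map (starRingEnd ℂ) * q).eval (x : ℂ) * (w0R M N x : ℂ) =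
      ((‖q.eval (x : ℂ)‖ ^ 2 * w0R M N x : ℝ) : ℂ) := by
    intro x
    have : (q.map (starRingEnd ℂ)).eval (x : ℂ) = starRingEnd ℂ (q.eval (x : ℂ)) := by
      rw [eval_map, ← eval₂_id (p := q), hom_eval₂, RingHom.comp_id, Complex.conj_ofReal]
    rw [eval_mul, this, Complex.conj_mul']
    push_cast
    rfl
  have hi : IntegrableOn (fun x : ℝ => ‖q.eval (x : ℂ)‖ ^ 2 * w0R M N x) (Ioi 0) := by
    have h := (integrableOn_eval_mul_w0R hNM (q.map (starRingEnd ℂ) * q)).integrable.re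
    refine h.congr (Filter.Eventually.of_forall fun x => ?_)
    simp only [hev]
    exact Complex.ofReal_re _
  have hw : ∀ x ∈ Ioi (0 : ℝ), 0 < w0R M N x := fun x hx =>
    mul_pos (pow_pos hx _) (Real.exp_pos _)
  have h0 : lagInt hNM (q.map (starRingEnd ℂ) * q) =
      ((∫ x in Ioi (0 : ℝ), ‖q.eval (x : ℂ)‖ ^ 2 * w0R M N x : ℝ) : ℂ) := by
    rw [← integral_complex_ofReal]
    exact integral_congr_ae (Filter.Eventually.of_forall hev)
  rw [h0]
  have hpos : 0 < ∫ x in Ioi (0 : ℝ), ‖q.eval (x : ℂ)‖ ^ 2 * w0R M N x := by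
    rw [setIntegral_pos_iff_support_of_nonneg_ae _ hi]
    · have hfin : {x : ℝ | q.eval (x : ℂ) = 0}.Finite := by
        refine Finite.subset ((q.rootSet_finite ℂ).preimage Complex.ofReal_injective.injOn) ?_
        intro x hx
        simpa [mem_rootSet, hq] using hx
      have hsub : Ioi (0 : ℝ) \ {x : ℝ | q.eval (x : ℂ) = 0} ⊆
          Function.support (fun x : ℝ => ‖q.eval (x : ℂ)‖ ^ 2 * w0R M N x) ∩ Ioi 0 := by
        rintro x ⟨hx, hx'⟩
        exact ⟨mul_ne_zero (pow_ne_zero _ (norm_ne_zero_iff.2 hx')) (hw x hx).ne', hx⟩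
      refine lt_of_lt_of_le ?_ (measure_mono hsub)
      rw [measure_sdiff_null (hfin.measure_zero _)]
      simp
    · refine (ae_restrict_iff' measurableSet_Ioi).2 (Filter.Eventually.of_forall fun x hx => ?_)
      exact mul_nonneg (sq_nonneg _) (hw x hx).le
  exact_mod_cast hpos.ne'

end Analysis

section Algebra

/-- If `T` raises degrees by at most two and `T`, `A`, `B` are independent on polynomials of degree
less than `n`, then the image of `T` together with `A`, `B` fills the polynomials of degree
less than `n + 2`. -/
lemma exists_eq_map_add_smul_add_smul {K : Type*} [Field K] (T : K[X] →ₗ[K] K[X]) (n : ℕ)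
    (hT : ∀ q ∈ degreeLT K n, T q ∈ degreeLT K (n + 2)) {A B : K[X]}
    (hA : A ∈ degreeLT K (n + 2)) (hB : B ∈ degreeLT K (n + 2))
    (hinj : ∀ q ∈ degreeLT K n, ∀ a b : K, T q + a • A + b • B = 0 → q = 0 ∧ a = 0 ∧ b = 0)
    {p : K[X]} (hp : p ∈ degreeLT K (n + 2)) :
    ∃ q ∈ degreeLT K n, ∃ a b : K, p = T q + a • A + b • B := by
  have : FiniteDimensional K (degreeLT K n) := (degreeLTEquiv K n).symm.finiteDimensional
  have : FiniteDimensional K (degreeLT K (n + 2)) :=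
    (degreeLTEquiv K (n + 2)).symm.finiteDimensional
  let Φ : (degreeLT K n × K × K) →ₗ[K] degreeLT K (n + 2) :=
    (T.restrict hT).coprod
      ((LinearMap.toSpanSingleton K _ ⟨A, hA⟩).coprod (LinearMap.toSpanSingleton K _ ⟨B, hB⟩))
  have hΦ : ∀ z, (Φ z : K[X]) = T z.1 + z.2.1 • A + z.2.2 • B := fun z => by
    simp [Φ, add_assoc]
  have hdim : Module.finrank K (degreeLT K n × K × K) = Module.finrank K (degreeLT K (n + 2)) := by
    rw [Module.finrank_prod, Module.finrank_prod, (degreeLTEquiv K n).finrank_eq,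
      (degreeLTEquiv K (n + 2)).finrank_eq]
    simp
  have hin : Function.Injective Φ := by
    rw [injective_iff_map_eq_zero]
    rintro ⟨q, a, b⟩ hz
    have h := hΦ (q, a, b)
    rw [hz] at h
    obtain ⟨h1, h2, h3⟩ := hinj q q.2 a b h.symm
    simp only [Prod.mk_eq_zero]
    exact ⟨Subtype.ext h1, h2, h3⟩
  obtain ⟨⟨q, a, b⟩, hz⟩ :=
    (LinearMap.injective_iff_surjective_of_finrank_eq_finrank hdim).1 hin ⟨p, hp⟩
  exact ⟨q, q.2, a, b, by rw [← hΦ (q, a, b), hz]⟩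

/-- A linear functional vanishing on `1, …, X ^ (n - 1)` vanishes on polynomials of degree less
than `n`. -/
lemma map_eq_zero_of_mem_degreeLT {K : Type*} [Field K] (φ : K[X] →ₗ[K] K) {n : ℕ}
    (h : ∀ j < n, φ (X ^ j) = 0) {p : K[X]} (hp : p ∈ degreeLT K n) : φ p = 0 := by
  classical
  rw [degreeLT_eq_span_X_pow] at hp
  refine (Submodule.span_le (p := LinearMap.ker φ)).2 ?_ hp
  intro x hx
  simp only [Finset.coe_image, Finset.coe_range, Set.mem_image, Set.mem_Iio] at hx
  obtain ⟨j, hj, rfl⟩ := hx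
  exact h j hj

lemma mem_degreeLT_iff_coeff {K : Type*} [Field K] {n : ℕ} {p : K[X]} :
    p ∈ degreeLT K n ↔ ∀ m, n ≤ m → p.coeff m = 0 := by
  rw [mem_degreeLT, degree_lt_iff_coeff_zero]

variable {M N : ℕ} {t : ℂ}

/-- The operator `T` as a linear map. -/
noncomputable def TqLin (M N : ℕ) (t : ℂ) : ℂ[X] →ₗ[ℂ] ℂ[X] where
  toFun := Tq M N t
  map_add' p q := by simp only [Tq, derivative_add]; ring
  map_smul' c p := by simp only [Tq, smul_eq_C_mul, derivative_C_mul, RingHom.id_apply]; ring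

@[simp] lemma TqLin_apply (q : ℂ[X]) : TqLin M N t q = Tq M N t q := rfl

lemma Tq_eq (q : ℂ[X]) :
    Tq M N t q = X * (C t * derivative q) - X * (X * derivative q)
      + C (t * (1 + ((M : ℂ) - N - 1) / 2)) * q
      - X * (C (3 / 2 + M / 2 * t + ((M : ℂ) - N - 1) / 2) * q)
      + X * (X * (C ((M : ℂ) / 2) * q)) := by
  have e : (2 : ℂ[X]) = C 2 := rfl
  have e1 : (C (3 / 2) : ℂ[X]) = C 2 - C (1 / 2) := by rw [← C_sub]; norm_num
  simp only [Tq, C_mul, C_add, C_1, e1, e]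
  ring

lemma coeff_Tq (q : ℂ[X]) (k : ℕ) :
    (Tq M N t q).coeff (k + 2) = M / 2 * q.coeff k
      - ((k + 1) + (3 / 2 + M / 2 * t + ((M : ℂ) - N - 1) / 2)) * q.coeff (k + 1)
      + t * ((k + 2) + (1 + ((M : ℂ) - N - 1) / 2)) * q.coeff (k + 2) := by
  rw [Tq_eq]
  simp only [coeff_add, coeff_sub, coeff_X_mul, coeff_C_mul, coeff_derivative]
  push_cast
  ring

lemma Tq_mem_degreeLT {n : ℕ} {q : ℂ[X]} (hq : q ∈ degreeLT ℂ n) :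
    Tq M N t q ∈ degreeLT ℂ (n + 2) := by
  rw [mem_degreeLT_iff_coeff] at hq ⊢
  intro m hm
  obtain ⟨k, rfl⟩ := Nat.exists_eq_add_of_le' (show 2 ≤ m by omega)
  rw [coeff_Tq, hq k (by omega), hq (k + 1) (by omega), hq (k + 2) (by omega)]
  ring

lemma eq_zero_of_forall_lagInt_eq_zero (hNM : N < M) {n : ℕ} {q : ℂ[X]} (hq : q ∈ degreeLT ℂ n)
    (h : ∀ p ∈ degreeLT ℂ n, lagInt hNM (p * q) = 0) : q = 0 := by
  by_contra hq0
  refine lagInt_conj_mul_ne_zero hNM hq0 (h _ ?_)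
  rw [mem_degreeLT] at hq ⊢
  exact (degree_map_le).trans_lt hq

variable {L : ℕ → ℂ[X]}

lemma IsLag.coeff_self (hL : IsLag M N L) (n : ℕ) : (L n).coeff n = 1 := by
  have h := (hL n).1.coeff_natDegree
  rwa [(hL n).2.1] at h

lemma IsLag.mem_degreeLT (hL : IsLag M N L) {n m : ℕ} (h : n < m) : L n ∈ degreeLT ℂ m := by
  rw [Polynomial.mem_degreeLT, degree_eq_natDegree (hL n).1.ne_zero, (hL n).2.1]
  exact_mod_cast h

lemma IsLag.lagInt_mul_eq_zero (hL : IsLag M N L) (hNM : N < M) {n : ℕ} {p : ℂ[X]}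
    (hp : p ∈ degreeLT ℂ n) : lagInt hNM (L n * p) = 0 :=
  map_eq_zero_of_mem_degreeLT (lagInt hNM ∘ₗ LinearMap.mulLeft ℂ (L n))
    (fun j hj => by
      have := (hL n).2.2 j hj
      rwa [inner2C_eq_lagInt hNM] at this) hp

lemma IsLag.lagInt_mul_eq (hL : IsLag M N L) (hNM : N < M) {n : ℕ} {p : ℂ[X]}
    (hp : p ∈ degreeLT ℂ (n + 1)) : lagInt hNM (L n * p) = p.coeff n * hC M N L n := by
  have h : p - p.coeff n • L n ∈ degreeLT ℂ n := by
    rw [mem_degreeLT_iff_coeff] at hp ⊢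
    intro m hm
    rcases hm.eq_or_lt with rfl | hm
    · simp [hL.coeff_self]
    · have := mem_degreeLT_iff_coeff.1 (hL.mem_degreeLT hm) m le_rfl
      simp [this, hp m hm]
  have h0 := hL.lagInt_mul_eq_zero hNM h
  rw [mul_sub, mul_smul_comm, map_sub, map_smul, smul_eq_mul, ← hC_eq_lagInt, sub_eq_zero] at h0
  exact h0

lemma IsLag.hC_ne_zero (hL : IsLag M N L) (hNM : N < M) (n : ℕ) : hC M N L n ≠ 0 := by
  have hne : L n ≠ 0 := (hL n).1.ne_zero
  have h := lagInt_conj_mul_ne_zero hNM hne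
  have hmem : (L n).map (starRingEnd ℂ) ∈ degreeLT ℂ (n + 1) := by
    rw [Polynomial.mem_degreeLT]
    exact (degree_map_le).trans_lt (Polynomial.mem_degreeLT.1 (hL.mem_degreeLT n.lt_succ_self))
  rw [mul_comm, hL.lagInt_mul_eq hNM hmem, coeff_map, hL.coeff_self, map_one, one_mul] at h
  exact h

/-- The recurrence of the subleading coefficients of the Laguerre polynomials. -/
lemma IsLag.coeff_sub_coeff (hL : IsLag M N L) (hNM : N < M) (k : ℕ) :
    (M : ℂ) * ((L (k + 1)).coeff k - (L (k + 2)).coeff (k + 1)) = 2 * (k + 1) + (M - N) + 1 := by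
  set n := k + 1 with hn
  have hparts := lagInt_by_parts hNM (L n * L n)
  have hc := mem_degreeLT_iff_coeff.1 (hL.mem_degreeLT n.lt_succ_self)
  have hd : X * derivative (L n) ∈ degreeLT ℂ (n + 1) := by
    rw [mem_degreeLT_iff_coeff]
    intro m hm
    obtain ⟨j, rfl⟩ := Nat.exists_eq_add_of_le' (show 1 ≤ m by omega)
    rw [coeff_X_mul, coeff_derivative, hc _ hm, zero_mul]
  have h1 := hL.lagInt_mul_eq hNM hd
  have hx : X * L n - L (n + 1) ∈ degreeLT ℂ (n + 1) := by
    rw [mem_degreeLT_iff_coeff]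
    intro m hm
    obtain ⟨j, rfl⟩ := Nat.exists_eq_add_of_le' (show 1 ≤ m by omega)
    rw [coeff_sub, coeff_X_mul]
    rcases hm.eq_or_lt with he | hlt
    · obtain rfl : n = j := by omega
      rw [hL.coeff_self, hL.coeff_self, sub_self]
    · rw [hc j (by omega), mem_degreeLT_iff_coeff.1 (hL.mem_degreeLT hlt) _ le_rfl, sub_self]
  have h2 := hL.lagInt_mul_eq hNM hx
  have h3 := hL.lagInt_mul_eq_zero hNM (hL.mem_degreeLT n.lt_succ_self)
  rw [mul_sub, map_sub, mul_comm (L n) (L (n + 1)), h3, coeff_sub, sub_zero, hn, coeff_X_mul] at h2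
  rw [hn, coeff_X_mul, coeff_derivative, hL.coeff_self, ← hn] at h1
  have e1 : X * derivative (L n * L n) =
      L n * (X * derivative (L n)) + L n * (X * derivative (L n)) := by
    rw [derivative_mul]; ring
  have e2 : X * (L n * L n) = L n * (X * L n) := by ring
  rw [← hn] at h2
  rw [e1, e2, map_add, h1, h2, ← hC_eq_lagInt] at hparts
  apply mul_right_cancel₀ (hL.hC_ne_zero hNM n)
  linear_combination -hparts

/-- The Laguerre polynomial `L m` is skew-orthogonal to `T(q)` when `q` has degree less than `m`. -/
lemma IsLag.skew1_Tq_eq_zero (hL : IsLag M N L) (hNM : N < M) (ht : t.im ≠ 0) {m n : ℕ}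
    (hmn : n ≤ m) {q : ℂ[X]} (hq : q ∈ degreeLT ℂ n) : skew1 M N t (L m) (Tq M N t q) = 0 := by
  rw [skew1_Tq hNM ht, inner2C_eq_lagInt hNM]
  exact hL.lagInt_mul_eq_zero hNM (degreeLT_mono hmn hq)

/-- A nonzero pairing of `L (n + 1)` with `L n` makes the `c = 0` polynomial of degree `n + 3`
skew-orthogonal to all polynomials of degree less than `n + 2`. -/
lemma IsLag.skew1_oddSkew_eq_zero (hL : IsLag M N L) (hNM : N < M) (ht : t.im ≠ 0) (n : ℕ)
    (h1 : skew1 M N t (L (n + 1)) (L n) ≠ 0) {p : ℂ[X]} (hp : p ∈ degreeLT ℂ (n + 2)) :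
    skew1 M N t (L (n + 3)
      - C (skew1 M N t (L (n + 3)) (L n) / skew1 M N t (L (n + 1)) (L n)) * L (n + 1)
      + C (skew1 M N t (L (n + 3)) (L (n + 1)) / skew1 M N t (L (n + 1)) (L n)) * L n) p = 0 := by
  have hself : ∀ f : ℂ[X], skew1 M N t f f = 0 := fun f => by
    have := skew1_swap hNM ht f f
    linear_combination this / 2
  have hsw := skew1_swap hNM ht (L n) (L (n + 1))
  obtain ⟨q, hq, a, b, rfl⟩ := exists_eq_map_add_smul_add_smul (TqLin M N t) n
    (fun q hq => Tq_mem_degreeLT hq) (hL.mem_degreeLT (show n + 1 < n + 2 by omega))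
    (hL.mem_degreeLT (show n < n + 2 by omega)) (fun q hq a b h => by
      have hlin : ∀ f, skew1 M N t f (Tq M N t q) + a * skew1 M N t f (L (n + 1))
          + b * skew1 M N t f (L n) = 0 := fun f => by
        have hf := congrArg (skewForm hNM ht f) h
        simp only [map_add, map_smul, map_zero, smul_eq_mul] at hf
        exact hf
      have ha := hlin (L n)
      rw [hL.skew1_Tq_eq_zero hNM ht le_rfl hq, hself, hsw] at ha
      have hb := hlin (L (n + 1))
      rw [hL.skew1_Tq_eq_zero hNM ht (Nat.le_succ n) hq, hself] at hb
      have ha0 : a = 0 := by simpa [h1] using ha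
      have hb0 : b = 0 := by simpa [h1] using hb
      refine ⟨eq_zero_of_forall_lagInt_eq_zero hNM hq fun f _ => ?_, ha0, hb0⟩
      have hf := hlin f
      rw [skew1_Tq hNM ht, inner2C_eq_lagInt hNM, ha0, hb0] at hf
      simpa using hf) hp
  simp only [← smul_eq_C_mul, ← skewForm_apply hNM ht]
  simp only [map_add, map_sub, map_smul, LinearMap.add_apply, LinearMap.sub_apply,
    LinearMap.smul_apply, smul_eq_mul, skewForm_apply, TqLin_apply]
  rw [hL.skew1_Tq_eq_zero hNM ht (show n ≤ n + 3 by omega) hq,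
    hL.skew1_Tq_eq_zero hNM ht (show n ≤ n + 1 by omega) hq,
    hL.skew1_Tq_eq_zero hNM ht le_rfl hq, hself, hself, hsw]
  field_simp
  ring

end Algebra

/-- Assume `N` even, `N ≥ 6`, `⟨L_{N−1},L_{N−2}⟩₁ ≠ 0` and
`⟨L_{N−3},L_{N−4}⟩₁ ≠ 0`.  With `π_{N,1}` and `π_{N+1,1}` the monic skew-orthogonal
polynomials (`π_{N+1,1}` with `c = 0`), for each `l ∈ {3,4}` there exist a unique
polynomial `q_l` of degree `≤ N−1` and unique constants `Q_{l−2,1}, Q_{l−2,2}` with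
`L_{N−l} = T(q_l) + Q_{l−2,1}·π_{N+1,1} + Q_{l−2,2}·π_{N,1}`, and the constants are
given by the stated formulas. -/
theorem stmt_14 (M N : ℕ) (hNe : Even N) (hN : 6 ≤ N) (hNM : N < M)
    (t : ℂ) (ht : t.im ≠ 0)
    (L : ℕ → Polynomial ℂ) (hL : IsLag M N L)
    (h1 : skew1 M N t (L (N - 1)) (L (N - 2)) ≠ 0)
    (h2 : skew1 M N t (L (N - 3)) (L (N - 4)) ≠ 0)
    (piN : Polynomial ℂ)
    (hpiN : piN.Monic ∧ piN.natDegree = N ∧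
      ∀ j, j < N → skew1 M N t piN (Polynomial.X ^ j) = 0)
    (piN1 : Polynomial ℂ)
    (hpiN1 : piN1 = L (N + 1)
      - Polynomial.C (skew1 M N t (L (N + 1)) (L (N - 2)) /
          skew1 M N t (L (N - 1)) (L (N - 2))) * L (N - 1)
      + Polynomial.C (skew1 M N t (L (N + 1)) (L (N - 1)) /
          skew1 M N t (L (N - 1)) (L (N - 2))) * L (N - 2))
    (l : ℕ) (hl : l = 3 ∨ l = 4) :
    (∃! qQ : Polynomial ℂ × ℂ × ℂ, qQ.1.natDegree ≤ N - 1 ∧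
        L (N - l) = Tq M N t qQ.1 + Polynomial.C qQ.2.1 * piN1 +
          Polynomial.C qQ.2.2 * piN) ∧
    (∀ q : Polynomial ℂ, ∀ Q1 Q2 : ℂ, q.natDegree ≤ N - 1 →
      L (N - l) = Tq M N t q + Polynomial.C Q1 * piN1 + Polynomial.C Q2 * piN →
      Q1 = -(M : ℂ) * skew1 M N t (L (N - 1)) (L (N - l)) / (2 * hC M N L (N - 1)) ∧
      Q2 = ((M : ℂ) * t - ((N : ℂ) + (M : ℂ))) *
              skew1 M N t (L (N - 1)) (L (N - l)) / (2 * hC M N L (N - 1))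
            - (M : ℂ) * skew1 M N t (L (N - 2)) (L (N - l)) / (2 * hC M N L (N - 2))) := by
  obtain ⟨n, rfl⟩ : ∃ n, N = n + 2 := ⟨N - 2, by omega⟩
  have hl1 : n + 2 - l < n + 2 := by omega
  generalize n + 2 - l = m at hl1 ⊢
  rw [show n + 2 - 1 = n + 1 from rfl, show n + 2 - 2 = n from rfl] at *
  obtain ⟨hmonic, hdeg, horth⟩ := hpiN
  have hBc : piN.coeff (n + 2) = 1 := by rw [← hdeg]; exact hmonic.coeff_natDegree
  have hB : piN ∈ degreeLT ℂ (n + 2 + 1) := by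
    rw [mem_degreeLT, degree_eq_natDegree hmonic.ne_zero, hdeg]
    exact_mod_cast Nat.lt_succ_self _
  have hB' := mem_degreeLT_iff_coeff.1 hB
  have horthB : ∀ p ∈ degreeLT ℂ (n + 2), skew1 M (n + 2) t p piN = 0 := fun p hp => by
    rw [skew1_swap hNM ht, neg_eq_zero]
    exact map_eq_zero_of_mem_degreeLT (skewForm hNM ht piN) horth hp
  have horthA : ∀ p ∈ degreeLT ℂ (n + 2), skew1 M (n + 2) t p piN1 = 0 := fun p hp => by
    rw [skew1_swap hNM ht, neg_eq_zero, hpiN1]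
    exact hL.skew1_oddSkew_eq_zero hNM ht n h1 hp
  have hLc : ∀ {i j : ℕ}, i < j → (L i).coeff j = 0 := fun h =>
    mem_degreeLT_iff_coeff.1 (hL.mem_degreeLT h) _ le_rfl
  have hAc : ∀ j, n + 1 < j → piN1.coeff j = (L (n + 3)).coeff j := fun j hj => by
    rw [hpiN1, coeff_add, coeff_sub, coeff_C_mul, coeff_C_mul, hLc hj, hLc (by omega : n < j)]
    ring
  have hA : piN1 ∈ degreeLT ℂ (n + 2 + 2) := mem_degreeLT_iff_coeff.2 fun j hj => by
    rw [hAc j (by omega), hLc (by omega)]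
  have hA1 : piN1.coeff (n + 3) = 1 := by rw [hAc _ (by omega), hL.coeff_self]
  have hmemq : ∀ q : ℂ[X], q.natDegree ≤ n + 1 ↔ q ∈ degreeLT ℂ (n + 2) := fun q => by
    rw [mem_degreeLT_iff_coeff, natDegree_le_iff_coeff_eq_zero]; rfl
  have hpair : ∀ r q : ℂ[X], ∀ a b : ℂ, r = Tq M (n + 2) t q + a • piN1 + b • piN →
      ∀ p ∈ degreeLT ℂ (n + 2), skew1 M (n + 2) t p r = lagInt hNM (p * q) := by
    intro r q a b h p hp
    have hf := congrArg (skewForm hNM ht p) h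
    simp only [map_add, map_smul, smul_eq_mul] at hf
    simp only [skewForm_apply] at hf
    rw [hf, horthA p hp, horthB p hp, skew1_Tq hNM ht, inner2C_eq_lagInt hNM]
    ring
  have hinj : ∀ q ∈ degreeLT ℂ (n + 2), ∀ a b : ℂ,
      TqLin M (n + 2) t q + a • piN1 + b • piN = 0 → q = 0 ∧ a = 0 ∧ b = 0 := by
    intro q hq a b h
    have hq0 : q = 0 := eq_zero_of_forall_lagInt_eq_zero hNM hq fun p hp => by
      rw [← hpair 0 q a b h.symm p hp]
      exact map_zero (skewForm hNM ht p)
    rw [hq0, map_zero, zero_add] at h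
    have ha : a = 0 := by
      simpa [hA1, hB' (n + 3) le_rfl] using congrArg (fun p => coeff p (n + 3)) h
    have hb : b = 0 := by
      simpa [ha, hBc] using congrArg (fun p => coeff p (n + 2)) h
    exact ⟨hq0, ha, hb⟩
  simp only [← smul_eq_C_mul, hmemq]
  refine ⟨?_, ?_⟩
  · obtain ⟨q, hq, a, b, h⟩ := exists_eq_map_add_smul_add_smul (TqLin M (n + 2) t) (n + 2)
      (fun q hq => Tq_mem_degreeLT hq) hA (degreeLT_mono (by omega) hB) hinj
      (hL.mem_degreeLT (show m < n + 2 + 2 by omega))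
    refine ⟨(q, a, b), ⟨hq, h⟩, ?_⟩
    rintro ⟨q', a', b'⟩ ⟨hq', h'⟩
    obtain ⟨e1, e2, e3⟩ := hinj (q' - q) (sub_mem hq' hq) (a' - a) (b' - b) (by
      rw [map_sub, sub_smul, sub_smul, TqLin_apply]
      linear_combination h - h')
    rw [sub_eq_zero.1 e1, sub_eq_zero.1 e2, sub_eq_zero.1 e3]
  · intro q Q1 Q2 hq h
    have hh1 := hL.hC_ne_zero hNM (n + 1)
    have hh0 := hL.hC_ne_zero hNM n
    have hqc := mem_degreeLT_iff_coeff.1 hq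
    have htop : skew1 M (n + 2) t (L (n + 1)) (L m) = q.coeff (n + 1) * hC M (n + 2) L (n + 1) := by
      rw [hpair _ q Q1 Q2 h _ (hL.mem_degreeLT (by omega)), hL.lagInt_mul_eq hNM hq]
    have hsub : q - q.coeff (n + 1) • L (n + 1) ∈ degreeLT ℂ (n + 1) := by
      rw [mem_degreeLT_iff_coeff]
      intro j hj
      rw [coeff_sub, coeff_smul, smul_eq_mul]
      rcases hj.eq_or_lt with rfl | hj
      · rw [hL.coeff_self]; ring
      · rw [hqc j hj, hLc hj]; ring
    have hnext : skew1 M (n + 2) t (L n) (L m) =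
        (q.coeff n - q.coeff (n + 1) * (L (n + 1)).coeff n) * hC M (n + 2) L n := by
      have e := hL.lagInt_mul_eq hNM hsub
      have e0 := hL.lagInt_mul_eq_zero hNM (hL.mem_degreeLT n.lt_succ_self)
      rw [mul_sub, mul_smul_comm, map_sub, map_smul, mul_comm (L n) (L (n + 1)), e0, smul_zero,
        sub_zero, coeff_sub, coeff_smul, smul_eq_mul] at e
      rw [hpair _ q Q1 Q2 h _ (hL.mem_degreeLT (by omega)), e]
    have hc3 := congrArg (fun p => coeff p (n + 1 + 2)) h
    have hc2 := congrArg (fun p => coeff p (n + 2)) h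
    simp only [coeff_add, coeff_smul, smul_eq_mul, coeff_Tq] at hc3 hc2
    rw [hLc (by omega), hqc (n + 1 + 1) le_rfl, hqc (n + 1 + 2) (by omega), hA1,
      hB' (n + 1 + 2) le_rfl] at hc3
    rw [hLc hl1, hqc (n + 2) le_rfl, hBc, hAc _ (by omega)] at hc2
    have r1 := hL.coeff_sub_coeff hNM n
    have r2 := hL.coeff_sub_coeff hNM (n + 1)
    push_cast at hc2 r1 r2 ⊢
    have hQ1 : Q1 = -(M : ℂ) / 2 * q.coeff (n + 1) := by linear_combination -hc3
    rw [htop, hnext]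
    refine ⟨?_, ?_⟩
    · rw [hQ1]; field_simp
    · have hQ2 : Q2 = ((M : ℂ) * t - (n + 2 + M)) * q.coeff (n + 1) / 2
          - M * (q.coeff n - q.coeff (n + 1) * (L (n + 1)).coeff n) / 2 := by
        rw [hQ1] at hc2
        linear_combination -hc2 - q.coeff (n + 1) / 2 * (r1 + r2)
      rw [hQ2]
      field_simp
end

section
/- For every real t > 4, the improper integral ∫₀^4 1/(√(x(4−x))·(t−x)) dx converges and equals π/√(t(t−4)). -/
open Real Set in
/-- On `(0, 4)`, a primitive of `1 / (√(x (4 - x)) (t - x))` is `arcsin ∘ u / √(t (t - 4))`, where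
`u` is the Möbius map with pole `t` sending `0, 4` to `-1, 1`. -/
theorem hasDerivAt_arcsin_moebius_div {t x : ℝ} (ht : 4 < t) (hx : x ∈ Ioo (0 : ℝ) 4) :
    HasDerivAt (fun y => arcsin (((t - 2) * y - 2 * t) / (2 * (t - y))) / √(t * (t - 4)))
      (1 / (√(x * (4 - x)) * (t - x))) x := by
  obtain ⟨hx0, hx4⟩ := hx
  have htx : 0 < t - x := by linarith
  have hs : 0 < t * (t - 4) := mul_pos (by linarith) (by linarith)
  have hr : 0 < x * (4 - x) := mul_pos hx0 (by linarith)
  have hs' : 0 < √(t * (t - 4)) := sqrt_pos.2 hs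
  have hr' : 0 < √(x * (4 - x)) := sqrt_pos.2 hr
  have hsq : 1 - (((t - 2) * x - 2 * t) / (2 * (t - x))) ^ 2
      = t * (t - 4) * (x * (4 - x)) / (2 * (t - x)) ^ 2 := by
    field_simp
    ring
  have hpos : 0 < 1 - (((t - 2) * x - 2 * t) / (2 * (t - x))) ^ 2 := by
    rw [hsq]
    positivity
  have hroot : √(1 - (((t - 2) * x - 2 * t) / (2 * (t - x))) ^ 2)
      = √(t * (t - 4)) * √(x * (4 - x)) / (2 * (t - x)) := by
    rw [hsq, sqrt_div (by positivity), sqrt_mul hs.le, sqrt_sq (by positivity)]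
  have hu : HasDerivAt (fun y => ((t - 2) * y - 2 * t) / (2 * (t - y)))
      (t * (t - 4) / (2 * (t - x) ^ 2)) x := by
    have hnum : HasDerivAt (fun y => (t - 2) * y - 2 * t) ((t - 2) * 1) x :=
      ((hasDerivAt_id x).const_mul (t - 2)).sub_const (2 * t)
    have hden : HasDerivAt (fun y => 2 * (t - y)) (2 * (-1)) x :=
      ((hasDerivAt_id x).const_sub t).const_mul 2
    refine (hnum.div hden (by positivity)).congr_deriv ?_
    field_simp
    ring
  have harcsin := hasDerivAt_arcsin (x := ((t - 2) * x - 2 * t) / (2 * (t - x)))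
    (by intro h; rw [h] at hpos; norm_num at hpos)
    (by intro h; rw [h] at hpos; norm_num at hpos)
  refine ((harcsin.comp x hu).div_const (√(t * (t - 4)))).congr_deriv ?_
  rw [hroot]
  field_simp
  rw [sq_sqrt hs.le]

/-- For every real `t > 4`, the improper integral
`∫₀^4 1/(√(x(4−x))·(t−x)) dx` converges and equals `π/√(t(t−4))`. -/
theorem stmt_16 (t : ℝ) (ht : 4 < t) :
    IntervalIntegrable (fun x => 1 / (Real.sqrt (x * (4 - x)) * (t - x)))
        MeasureTheory.volume 0 4 ∧
      (∫ x in (0:ℝ)..4, 1 / (Real.sqrt (x * (4 - x)) * (t - x)))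
        = Real.pi / Real.sqrt (t * (t - 4)) := by
  have hcont : ContinuousOn (fun y => Real.arcsin (((t - 2) * y - 2 * t) / (2 * (t - y)))
      / Real.sqrt (t * (t - 4))) (Set.Icc 0 4) := by
    refine (Real.continuous_arcsin.comp_continuousOn
      (ContinuousOn.div (by fun_prop) (by fun_prop) ?_)).div_const _
    intro x hx
    have : 0 < t - x := by linarith [hx.2]
    positivity
  have hint : IntervalIntegrable (fun x => 1 / (Real.sqrt (x * (4 - x)) * (t - x)))
      MeasureTheory.volume 0 4 := by
    rw [intervalIntegrable_iff_integrableOn_Ioc_of_le (by norm_num)]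
    refine intervalIntegral.integrableOn_deriv_of_nonneg hcont
      (fun x hx => hasDerivAt_arcsin_moebius_div ht hx) fun x hx => ?_
    have : 0 < t - x := by linarith [hx.2]
    positivity
  refine ⟨hint, ?_⟩
  rw [intervalIntegral.integral_eq_sub_of_hasDerivAt_of_le (by norm_num) hcont
    (fun x hx => hasDerivAt_arcsin_moebius_div ht hx) hint]
  have ht0 : t ≠ 0 := by linarith
  have ht4 : t - 4 ≠ 0 := by linarith
  have hright : ((t - 2) * 4 - 2 * t) / (2 * (t - 4)) = 1 := by
    field_simp
    ring
  have hleft : ((t - 2) * 0 - 2 * t) / (2 * (t - 0)) = -1 := by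
    rw [sub_zero]
    field_simp
    ring
  rw [hright, hleft, Real.arcsin_one, Real.arcsin_neg_one]
  ring
end

section
/- For every real t > 4, the improper integral ∫₀^4 (x−2)/(√(x(4−x))·(t−x)) dx converges and equals π·((t−2)/√(t(t−4)) − 1). -/
open Real Set MeasureTheory

/-- If `arcsin ∘ w` has a nonnegative derivative `f` on `(a, b)`, with `w` running continuously
from `-1` to `1` on `[a, b]`, then `f` is integrable on `[a, b]` with integral `π`. -/
theorem intervalIntegrable_and_integral_eq_pi_of_arcsin {w f : ℝ → ℝ} {a b : ℝ} (hab : a ≤ b)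
    (hw : ContinuousOn w (Icc a b)) (hwa : w a = -1) (hwb : w b = 1)
    (hderiv : ∀ x ∈ Ioo a b, HasDerivAt (fun y => arcsin (w y)) (f x) x)
    (hf : ∀ x ∈ Ioo a b, 0 ≤ f x) :
    IntervalIntegrable f volume a b ∧ ∫ x in a..b, f x = π := by
  have hcont : ContinuousOn (fun y => arcsin (w y)) (Icc a b) :=
    continuous_arcsin.comp_continuousOn hw
  have hint : IntervalIntegrable f volume a b :=
    (intervalIntegrable_iff_integrableOn_Ioc_of_le hab).2
      (intervalIntegral.integrableOn_deriv_of_nonneg hcont hderiv hf)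
  refine ⟨hint, ?_⟩
  rw [intervalIntegral.integral_eq_sub_of_hasDerivAt_of_le hab hcont hderiv hint, hwa, hwb,
    arcsin_one, arcsin_neg_one]
  ring

/-- Derivative of `arcsin ∘ w` when `√(1 - w ^ 2)` is known in closed form. -/
theorem HasDerivAt.arcsin_of_one_sub_sq {w : ℝ → ℝ} {w' r x : ℝ} (hw : HasDerivAt w w' x)
    (hr : 0 < r) (h : 1 - w x ^ 2 = r ^ 2) :
    HasDerivAt (fun y => Real.arcsin (w y)) (w' / r) x := by
  have hr2 : 0 < r ^ 2 := by positivity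
  have h1 : w x ≠ -1 := fun e => by rw [e] at h; linarith
  have h2 : w x ≠ 1 := fun e => by rw [e] at h; linarith
  have := (hasDerivAt_arcsin h1 h2).comp x hw
  rw [h, sqrt_sq hr.le, one_div_mul_eq_div] at this
  exact this

theorem integral_inv_sqrt_mul_four_sub :
    IntervalIntegrable (fun x : ℝ => 1 / √(x * (4 - x))) volume 0 4 ∧
      ∫ x in (0 : ℝ)..4, 1 / √(x * (4 - x)) = π := by
  refine intervalIntegrable_and_integral_eq_pi_of_arcsin (w := fun x => (x - 2) / 2)
    (by norm_num) (by fun_prop) (by norm_num) (by norm_num) (fun x hx => ?_)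
    (fun x _ => by positivity)
  have hpos : 0 < x * (4 - x) := mul_pos hx.1 (sub_pos.2 hx.2)
  have hr : 0 < √(x * (4 - x)) := sqrt_pos.2 hpos
  have hw : HasDerivAt (fun y : ℝ => (y - 2) / 2) (1 / 2) x :=
    ((hasDerivAt_id x).sub_const 2).div_const 2
  convert hw.arcsin_of_one_sub_sq (r := √(x * (4 - x)) / 2) (by positivity) ?_ using 1
  · field_simp
  · rw [div_pow, div_pow, sq_sqrt hpos.le]
    ring

theorem integral_inv_sqrt_mul_four_sub_mul_sub {t : ℝ} (ht : 4 < t) :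
    IntervalIntegrable (fun x : ℝ => √(t * (t - 4)) / (√(x * (4 - x)) * (t - x))) volume 0 4 ∧
      ∫ x in (0 : ℝ)..4, √(t * (t - 4)) / (√(x * (4 - x)) * (t - x)) = π := by
  have hpt : 0 < t * (t - 4) := mul_pos (by linarith) (by linarith)
  have hs : 0 < √(t * (t - 4)) := sqrt_pos.2 hpt
  have h4 : t - 4 ≠ 0 := by linarith
  have h0 : t ≠ 0 := by linarith
  refine intervalIntegrable_and_integral_eq_pi_of_arcsin
    (w := fun x => ((t - 2) * (x - 2) - 4) / (2 * (t - x))) (by norm_num)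
    (ContinuousOn.div (by fun_prop) (by fun_prop) fun x hx => by linarith [hx.2])
    (by field_simp; ring) (by field_simp; ring) (fun x hx => ?_) (fun x hx => ?_)
  · have hpos : 0 < x * (4 - x) := mul_pos hx.1 (sub_pos.2 hx.2)
    have hr : 0 < √(x * (4 - x)) := sqrt_pos.2 hpos
    have htx : 0 < t - x := by linarith [hx.2]
    have hw : HasDerivAt (fun y : ℝ => ((t - 2) * (y - 2) - 4) / (2 * (t - y)))
        (t * (t - 4) / (2 * (t - x) ^ 2)) x := by
      refine HasDerivAt.congr_deriv (((((hasDerivAt_id' x).sub_const 2).const_mul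
        (t - 2)).sub_const 4).div (((hasDerivAt_id' x).const_sub t).const_mul 2)
        (by positivity)) ?_
      field_simp
      ring
    convert hw.arcsin_of_one_sub_sq
      (r := √(t * (t - 4)) * √(x * (4 - x)) / (2 * (t - x))) (by positivity) ?_ using 1
    · field_simp
      rw [sq_sqrt hpt.le]
    · rw [div_pow, div_pow, mul_pow (√_), sq_sqrt hpos.le, sq_sqrt hpt.le]
      field_simp
      ring
  · have htx : 0 < t - x := by linarith [hx.2]
    positivity


/-- For every real `t > 4`, the improper integral
`∫₀^4 (x−2)/(√(x(4−x))·(t−x)) dx` converges and equals `π·((t−2)/√(t(t−4)) − 1)`. -/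
theorem stmt_17 (t : ℝ) (ht : 4 < t) :
    IntervalIntegrable (fun x => (x - 2) / (Real.sqrt (x * (4 - x)) * (t - x)))
        MeasureTheory.volume 0 4 ∧
      (∫ x in (0:ℝ)..4, (x - 2) / (Real.sqrt (x * (4 - x)) * (t - x)))
        = Real.pi * ((t - 2) / Real.sqrt (t * (t - 4)) - 1) := by
  obtain ⟨hA, hA'⟩ := integral_inv_sqrt_mul_four_sub
  obtain ⟨hB, hB'⟩ := integral_inv_sqrt_mul_four_sub_mul_sub ht
  have hs : 0 < √(t * (t - 4)) := sqrt_pos.2 (mul_pos (by linarith) (by linarith))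
  set s := √(t * (t - 4))
  have hB2 := hB.const_mul ((t - 2) / s)
  have key : EqOn (fun x => (t - 2) / s * (s / (√(x * (4 - x)) * (t - x))) - 1 / √(x * (4 - x)))
      (fun x => (x - 2) / (√(x * (4 - x)) * (t - x))) (uIcc 0 4) := fun x hx => by
    rw [uIcc_of_le (by norm_num)] at hx
    have htx : t - x ≠ 0 := by linarith [hx.2]
    rcases eq_or_ne (√(x * (4 - x))) 0 with h | h
    · simp [h]
    · field_simp
      ring
  refine ⟨(hB2.sub hA).congr (key.mono uIoc_subset_uIcc), ?_⟩
  rw [← intervalIntegral.integral_congr key, intervalIntegral.integral_sub hB2 hA,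
    intervalIntegral.integral_const_mul, hA', hB']
  ring
end

section
/- For x ∈ ℂ with Im x ≥ 0, define φ(x) = ∫_0^1 ((s(u)−4)/s(u))^{1/2} · s′(u) du, where s(u) = 4 + u·(x−4) parametrizes the straight line segment from 4 to x and the square root is the principal branch of the complex power (note that for Im x > 0 the segment lies in the closed upper half-plane and the integrand is continuous, vanishing at the endpoint s = 4). Then there exists δ > 0 such that Re φ(x) < 0 for every x with 0 < Im x < δ and −δ < Re x < 4. -/
/-- The principal square root maps the open upper half-plane into the open first quadrant. -/
theorem Complex.cpow_half_re_pos_im_pos {z : ℂ} (hz : 0 < z.im) :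
    0 < (z ^ ((1 : ℂ) / 2)).re ∧ 0 < (z ^ ((1 : ℂ) / 2)).im := by
  have habs : |z.re| < ‖z‖ := Complex.abs_re_lt_norm.2 hz.ne'
  rw [one_div, Complex.cpow_inv_two_re, Complex.cpow_inv_two_im_eq_sqrt hz.le]
  constructor <;> apply Real.sqrt_pos.2 <;> linarith [abs_lt.1 habs]

/-- Along the segment from `4` to `4 + w`, with `w` in the open upper half-plane, `(s - 4) / s`
lies in the open upper half-plane. -/
theorem Complex.im_mul_div_four_add_pos {w : ℂ} (hw : 0 < w.im) {u : ℝ} (hu : 0 < u) :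
    0 < ((u * w) / (4 + u * w)).im := by
  have him : 0 < u * w.im := mul_pos hu hw
  have hne : (4 + u * w : ℂ) ≠ 0 := fun h => by
    have := congrArg Complex.im h
    simp at this
    rcases this with h | h <;> linarith
  have hsq : 0 < Complex.normSq (4 + u * w) := Complex.normSq_pos.2 hne
  have : ((u * w) / (4 + u * w) : ℂ).im = 4 * (u * w.im) / Complex.normSq (4 + u * w) := by
    rw [Complex.div_im]
    simp
    field_simp
    ring
  rw [this]
  positivity

/-- For `w` in the open upper half-plane the integrand of `φ(4 + w)` is continuous. -/
theorem Complex.continuousOn_cpow_half_mul {w : ℂ} (hw : 0 < w.im) :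
    ContinuousOn (fun u : ℝ => ((u * w) / (4 + u * w) : ℂ) ^ ((1 : ℂ) / 2) * w)
      (Set.Icc 0 1) := by
  intro u hu
  refine ContinuousAt.continuousWithinAt (ContinuousAt.mul ?_ continuousAt_const)
  have hne : (4 + u * w : ℂ) ≠ 0 := fun h => by
    have him := congrArg Complex.im h
    simp [hw.ne'] at him
    simp [him] at h
  have hdiv : ContinuousAt (fun u : ℝ => ((u * w) / (4 + u * w) : ℂ)) u :=
    ContinuousAt.div (by fun_prop) (by fun_prop) hne
  refine ContinuousAt.comp (g := fun z : ℂ => z ^ ((1 : ℂ) / 2))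
    (Complex.continuousAt_cpow_const_of_re_pos ?_ (by norm_num)) hdiv
  rcases hu.1.eq_or_lt with rfl | hpos
  · simp
  · exact Or.inr (Complex.im_mul_div_four_add_pos hw hpos).ne'


/-- For `x` in the upper half-plane let
`φ(x) = ∫_0^1 ((s(u)−4)/s(u))^{1/2}·s′(u) du` with `s(u) = 4 + u(x−4)` (principal branch of
the complex square root).  Then there is `δ > 0` with `Re φ(x) < 0` whenever
`0 < Im x < δ` and `−δ < Re x < 4`. -/
theorem stmt_18 :
    ∃ δ : ℝ, 0 < δ ∧ ∀ x : ℂ, 0 < x.im → x.im < δ → -δ < x.re → x.re < 4 →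
      (∫ u in (0:ℝ)..1,
          (((4 + (u : ℂ) * (x - 4) - 4) / (4 + (u : ℂ) * (x - 4))) ^ ((1 : ℂ) / 2))
            * (x - 4)).re < 0 := by
  refine ⟨1, one_pos, fun x hx _ _ hre => ?_⟩
  simp only [add_sub_cancel_left]
  have hw : 0 < (x - 4).im := by simpa using hx
  have hwre : (x - 4).re < 0 := by simpa using hre
  have hint := (Complex.continuousOn_cpow_half_mul hw).intervalIntegrable_of_Icc
    (μ := MeasureTheory.volume) zero_le_one
  have hcomm := Complex.reCLM.intervalIntegral_comp_comm hint
  simp only [Complex.reCLM_apply] at hcomm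
  rw [← hcomm, ← neg_pos, ← intervalIntegral.integral_neg]
  have hint_re : IntervalIntegrable (fun u : ℝ =>
      -(((u * (x - 4)) / (4 + u * (x - 4)) : ℂ) ^ ((1 : ℂ) / 2) * (x - 4)).re)
      MeasureTheory.volume 0 1 :=
    ((Complex.continuous_re.comp_continuousOn
      (Complex.continuousOn_cpow_half_mul hw)).intervalIntegrable_of_Icc zero_le_one).neg
  refine intervalIntegral.intervalIntegral_pos_of_pos_on hint_re (fun u hu => ?_) one_pos
  obtain ⟨hr, hi⟩ := Complex.cpow_half_re_pos_im_pos (Complex.im_mul_div_four_add_pos hw hu.1)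
  rw [Complex.mul_re]
  linarith [mul_pos hi hw, mul_neg_of_pos_of_neg hr hwre]
end
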